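/- Let d ∈ ℕ, let G ∈ L¹_loc(ℝ^d), let β > d/2, C > 0, and let A ⊂ ℝ^d be a bounded open set with 0 ∈ A such that |G(x)| ≤ C·‖x‖^{−β} for all x ∈ ℝ^d \ A. Let R > 0, set G_R(x) := ∫_{B_R(x)} |G(y)| λ^d(dy) and A_{2R} := {x ∈ ℝ^d : dist(x, A) ≤ 2R}. Then G_R is essentially bounded on A_{2R}, and there exists C' > 0 such that for all α > 0, d_{G_R}(α) ≤ C'·(α^{−d/β} + 𝟙_{α ≤ ‖G_R‖_{L^∞(A_{2R})}}). -/

import Mathlib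

open MeasureTheory ENNReal Filter Topology

noncomputable section

/-- `ℝ^d` with the Euclidean structure. -/
abbrev Rd (d : ℕ) := EuclideanSpace ℝ (Fin d)

/-- The distribution function `d_f(α) = λ^d {x : |f x| > α}`. -/
def distFun {d : ℕ} (f : Rd d → ℝ) (α : ℝ) : ℝ≥0∞ := volume {x | α < |f x|}

/-- The convolution `(φ * G)(x) = ∫ G(y) φ(x - y) dy`. -/
def conv {d : ℕ} (φ G : Rd d → ℝ) (x : Rd d) : ℝ := ∫ y, G y * φ (x - y)

/-- `G_R(x) = ∫_{B_R(x)} |G(y)| dy`. -/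
def ballInt {d : ℕ} (G : Rd d → ℝ) (R : ℝ) (x : Rd d) : ℝ := ∫ y in Metric.ball x R, |G y|

theorem ballInt_nonneg {d : ℕ} (G : Rd d → ℝ) (R : ℝ) (x : Rd d) : 0 ≤ ballInt G R x :=
  integral_nonneg fun _ => abs_nonneg _

/-- On a ball around the origin, `ballInt G R` is bounded by the mass of `|G|` on a larger ball. -/
theorem ballInt_le_of_norm_le {d : ℕ} {G : Rd d → ℝ} (hG : LocallyIntegrable G volume)
    {R M : ℝ} {x : Rd d} (hx : ‖x‖ ≤ M) :
    ballInt G R x ≤ ∫ y in Metric.closedBall (0 : Rd d) (M + R), |G y| := by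
  refine setIntegral_mono_set (hG.integrableOn_isCompact (isCompact_closedBall _ _)).abs
    (ae_of_all _ fun _ => abs_nonneg _) (LE.le.eventuallyLE fun y hy => ?_)
  rw [mem_closedBall_zero_iff]
  rw [mem_ball_iff_norm] at hy
  linarith [norm_le_norm_add_norm_sub' y x]

/-- A point within distance `r` of a set contained in `closedBall 0 ρ` has norm at most
`ρ + r + 1`. -/
theorem norm_le_of_infDist_le {E : Type*} [SeminormedAddCommGroup E] {A : Set E}
    (hA : A.Nonempty) {ρ r : ℝ} (hρ : ∀ y ∈ A, ‖y‖ ≤ ρ) {x : E} (hx : Metric.infDist x A ≤ r) :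
    ‖x‖ ≤ ρ + r + 1 := by
  obtain ⟨y, hy, hxy⟩ := (Metric.infDist_lt_iff hA).1 (lt_of_le_of_lt hx (lt_add_one r))
  rw [dist_eq_norm] at hxy
  linarith [norm_le_norm_add_norm_sub' x y, hρ y hy]

/-- Away from `A`, `ballInt G R` inherits the power decay of `G`. -/
theorem ballInt_le_rpow {d : ℕ} {G : Rd d → ℝ} {β C R : ℝ} (hβ : 0 < β) (hC : 0 < C) (hR : 0 < R)
    {A : Set (Rd d)} (h0A : (0 : Rd d) ∈ A)
    (hGbd : ∀ x : Rd d, x ∉ A → |G x| ≤ C * ‖x‖ ^ (-β))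
    {x : Rd d} (hx : 2 * R < Metric.infDist x A) :
    ballInt G R x ≤
      C * 2 ^ β * volume.real (Metric.ball (0 : Rd d) R) * ‖x‖ ^ (-β) := by
  have hxn : 2 * R < ‖x‖ := by
    simpa using hx.trans_le (Metric.infDist_le_dist_of_mem h0A)
  have hx0 : 0 < ‖x‖ := by linarith
  have key : ∀ y ∈ Metric.ball x R, ‖|G y|‖ ≤ C * 2 ^ β * ‖x‖ ^ (-β) := by
    intro y hy
    have hyA : y ∉ A := by
      intro hyA
      have h := Metric.infDist_le_dist_of_mem (x := x) hyA
      rw [Metric.mem_ball'] at hy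
      linarith
    have hyn : ‖x‖ / 2 ≤ ‖y‖ := by
      rw [mem_ball_iff_norm'] at hy
      linarith [norm_le_norm_add_norm_sub' x y]
    rw [Real.norm_eq_abs, abs_abs]
    calc |G y| ≤ C * ‖y‖ ^ (-β) := hGbd y hyA
      _ ≤ C * (‖x‖ / 2) ^ (-β) := by
        gcongr ?_ * ?_
        exact Real.rpow_le_rpow_of_nonpos (by positivity) hyn (by linarith)
      _ = C * 2 ^ β * ‖x‖ ^ (-β) := by
        rw [Real.div_rpow hx0.le zero_le_two, Real.rpow_neg zero_le_two, div_inv_eq_mul]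
        ring
  have h := norm_setIntegral_le_of_norm_le_const (μ := volume) measure_ball_lt_top key
  have hv : volume.real (Metric.ball x R) = volume.real (Metric.ball (0 : Rd d) R) := by
    simp only [Measure.real, Measure.addHaar_ball_center]
  rw [hv] at h
  calc ballInt G R x ≤ ‖ballInt G R x‖ := le_abs_self _
    _ ≤ _ := h
    _ = _ := by ring

/-- The superlevel sets of `D * ‖x‖ ^ (-β)` have measure of order `α ^ (-(d / β))`. -/
theorem volume_superlevel_rpow_le {d : ℕ} {β D α : ℝ} (hβ : 0 < β) (hD : 0 < D) (hα : 0 < α) :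
    volume {x : Rd d | x ≠ 0 ∧ α < D * ‖x‖ ^ (-β)} ≤
      ENNReal.ofReal (D ^ ((d : ℝ) / β) * volume.real (Metric.ball (0 : Rd d) 1)) *
        ENNReal.ofReal (α ^ (-((d : ℝ) / β))) := by
  have hsub : {x : Rd d | x ≠ 0 ∧ α < D * ‖x‖ ^ (-β)} ⊆ Metric.ball 0 ((D / α) ^ (1 / β)) := by
    rintro x ⟨hx0, hx⟩
    have hxn : 0 < ‖x‖ := norm_pos_iff.2 hx0
    rw [mem_ball_zero_iff, one_div, Real.lt_rpow_inv_iff_of_pos hxn.le (by positivity) hβ,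
      lt_div_iff₀ hα]
    rwa [Real.rpow_neg hxn.le, ← div_eq_mul_inv, lt_div_iff₀ (by positivity), mul_comm] at hx
  have hexp : ((D / α) ^ (1 / β)) ^ d = D ^ ((d : ℝ) / β) * α ^ (-((d : ℝ) / β)) := by
    rw [← Real.rpow_natCast, ← Real.rpow_mul (by positivity), Real.div_rpow hD.le hα.le,
      Real.rpow_neg hα.le, div_eq_mul_inv, one_div_mul_eq_div]
  calc _ ≤ volume (Metric.ball (0 : Rd d) ((D / α) ^ (1 / β))) := measure_mono hsub
    _ = ENNReal.ofReal (D ^ ((d : ℝ) / β) * α ^ (-((d : ℝ) / β))) *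
          ENNReal.ofReal (volume.real (Metric.ball (0 : Rd d) 1)) := by
      rw [Measure.addHaar_ball_of_pos _ _ (by positivity), finrank_euclideanSpace_fin, hexp,
        ofReal_measureReal measure_ball_lt_top.ne]
    _ = _ := by
      rw [← ENNReal.ofReal_mul (by positivity), ← ENNReal.ofReal_mul (by positivity)]
      ring_nf

/-- On a measurable set, the superlevel set of `f` at height `α` is controlled by the measure of
the set, and is null as soon as `α` exceeds the essential supremum. -/
theorem measure_inter_superlevel_le {X : Type*} [MeasurableSpace X] {μ : Measure X} {S : Set X}
    (hS : MeasurableSet S) (f : X → ℝ) (α : ℝ) :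
    μ (S ∩ {x | α < |f x|}) ≤ μ S *
      Set.indicator {t : ℝ | ENNReal.ofReal t ≤ eLpNorm f ⊤ (μ.restrict S)}
        (fun _ => (1 : ℝ≥0∞)) α := by
  by_cases h : ENNReal.ofReal α ≤ eLpNorm f ⊤ (μ.restrict S)
  · rw [Set.indicator_of_mem (by exact h), mul_one]
    exact measure_mono Set.inter_subset_left
  · rw [Set.indicator_of_notMem (by exact h), mul_zero, nonpos_iff_eq_zero]
    have hae := (ae_restrict_iff' hS).1
      (enorm_ae_le_eLpNormEssSup f (μ.restrict S))
    refine measure_mono_null ?_ hae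
    rintro x ⟨hxS, hx⟩ hle
    refine h (le_trans ?_ ((hle hxS).trans_eq eLpNorm_exponent_top.symm))
    rw [← ofReal_norm]
    exact ENNReal.ofReal_le_ofReal (le_of_lt hx)

/-- if `|G(x)| ≤ C‖x‖^{-β}` outside a bounded open set `A ∋ 0` with `β > d/2`,
then `G_R` is essentially bounded on `A_{2R} = {x : dist(x,A) ≤ 2R}` and
`d_{G_R}(α) ≤ C'·(α^{-d/β} + 𝟙_{α ≤ ‖G_R‖_{L^∞(A_{2R})}})` for all `α > 0`. -/
theorem statement8 {d : ℕ} (hd : 0 < d) (G : Rd d → ℝ)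
    (hG : MeasureTheory.LocallyIntegrable G volume)
    (β C : ℝ) (hβ : (d : ℝ) / 2 < β) (hC : 0 < C)
    (A : Set (Rd d)) (hAo : IsOpen A) (hAb : Bornology.IsBounded A) (h0A : (0 : Rd d) ∈ A)
    (hGbd : ∀ x : Rd d, x ∉ A → |G x| ≤ C * ‖x‖ ^ (-β))
    (R : ℝ) (hR : 0 < R) :
    eLpNorm (ballInt G R) ⊤
        (volume.restrict {x : Rd d | Metric.infDist x A ≤ 2 * R}) < ⊤ ∧
    ∃ C' : ℝ, 0 < C' ∧ ∀ α : ℝ, 0 < α →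
      distFun (ballInt G R) α ≤ ENNReal.ofReal C' *
        (ENNReal.ofReal (α ^ (-((d : ℝ) / β))) +
          Set.indicator
            {t : ℝ | ENNReal.ofReal t ≤ eLpNorm (ballInt G R) ⊤
                (volume.restrict {x : Rd d | Metric.infDist x A ≤ 2 * R})}
            (fun _ => (1 : ℝ≥0∞)) α) := by
  have hβ0 : 0 < β := lt_of_le_of_lt (by positivity) hβ
  set S : Set (Rd d) := {x : Rd d | Metric.infDist x A ≤ 2 * R}
  obtain ⟨ρ, hρ⟩ := hAb.exists_norm_le
  have hSnorm : ∀ x ∈ S, ‖x‖ ≤ ρ + 2 * R + 1 := fun x hx =>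
    norm_le_of_infDist_le ⟨0, h0A⟩ hρ hx
  have hSm : MeasurableSet S :=
    (isClosed_le (Metric.continuous_infDist_pt A) continuous_const).measurableSet
  have hSfin : volume S ≠ ⊤ :=
    (isBounded_iff_forall_norm_le.2 ⟨_, hSnorm⟩).measure_lt_top.ne
  refine ⟨?_, ?_⟩
  · rw [eLpNorm_exponent_top]
    refine eLpNormEssSup_lt_top_of_ae_bound
      (C := ∫ y in Metric.closedBall (0 : Rd d) (ρ + 2 * R + 1 + R), |G y|) ?_
    filter_upwards [ae_restrict_mem hSm] with x hx
    rw [Real.norm_of_nonneg (ballInt_nonneg G R x)]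
    exact ballInt_le_of_norm_le hG (hSnorm x hx)
  set D : ℝ := C * 2 ^ β * volume.real (Metric.ball (0 : Rd d) R)
  have hD0 : 0 < D :=
    mul_pos (by positivity) (ENNReal.toReal_pos (Metric.measure_ball_pos _ _ hR).ne'
      measure_ball_lt_top.ne)
  set K : ℝ := D ^ ((d : ℝ) / β) * volume.real (Metric.ball (0 : Rd d) 1)
  have hK0 : 0 ≤ K := by positivity
  refine ⟨K + volume.real S + 1, by positivity, fun α hα => ?_⟩
  have hcover : {x | α < |ballInt G R x|} ⊆
      {x : Rd d | x ≠ 0 ∧ α < D * ‖x‖ ^ (-β)} ∪ (S ∩ {x | α < |ballInt G R x|}) := by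
    intro x hx
    by_cases hxS : x ∈ S
    · exact Or.inr ⟨hxS, hx⟩
    · have hxd : 2 * R < Metric.infDist x A := not_le.1 hxS
      refine Or.inl ⟨?_, lt_of_lt_of_le hx ?_⟩
      · rintro rfl
        rw [Metric.infDist_zero_of_mem h0A] at hxd
        linarith
      · rw [abs_of_nonneg (ballInt_nonneg G R x)]
        exact ballInt_le_rpow hβ0 hC hR h0A hGbd hxd
  rw [mul_add]
  refine (measure_mono hcover).trans ((measure_union_le _ _).trans (add_le_add ?_ ?_))
  · refine (volume_superlevel_rpow_le hβ0 hD0 hα).trans ?_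
    gcongr
    linarith [measureReal_nonneg (μ := volume) (s := S)]
  · refine (measure_inter_superlevel_le hSm _ α).trans ?_
    gcongr
    rw [← ofReal_measureReal hSfin]
    exact ENNReal.ofReal_le_ofReal (by linarith)
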